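/- arXiv:1003.4330 — 2 statements merged into one kernel-verified Lean document; each statement's English description precedes it below -/
import Mathlib

section
/- With X_{2k}(x) = ∫_{−∞}^x sign(t) h_{2k}(t) dt, one has lim_{k→∞} ∫_ℝ (X_{2k}(x))² dx = 2; equivalently, Σ_{i=0}^∞ C(1/2, i) = √2. -/
open MeasureTheory Real

/-- The normalized Hermite function of degree `k`:
`h_k(t) = (−1)^k (2^k k! √π)^{−1/2} e^{t²/2} (d/dt)^k(e^{−t²})`. -/
noncomputable def hermiteFun (k : ℕ) (t : ℝ) : ℝ :=
  (-1 : ℝ) ^ k * ((2 : ℝ) ^ k * (Nat.factorial k : ℝ) * Real.sqrt π) ^ (-(1 : ℝ) / 2) *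
    Real.exp (t ^ 2 / 2) * iteratedDeriv k (fun s : ℝ => Real.exp (-s ^ 2)) t

/-- Generalized binomial coefficient `C(a,i) = a(a−1)⋯(a−i+1)/i!`. -/
noncomputable def genBinom (a : ℝ) (i : ℕ) : ℝ :=
  (∏ j ∈ Finset.range i, (a - j)) / (Nat.factorial i : ℝ)

/-- `X_{2k}(x) = ∫_{−∞}^x sign(t) h_{2k}(t) dt`. -/
noncomputable def Xeven (k : ℕ) (x : ℝ) : ℝ :=
  ∫ t in Set.Iic x, Real.sign t * hermiteFun (2 * k) t

theorem genBinom_eq_choose (a : ℝ) (i : ℕ) : genBinom a i = Ring.choose a i := by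
  rw [Ring.choose_eq_smul, ← Polynomial.aeval_eq_smeval, Polynomial.aeval_def,
    Polynomial.eval₂_eq_eval_map, descPochhammer_map, descPochhammer_eval_eq_prod_range,
    genBinom, smul_eq_mul, div_eq_inv_mul]

theorem genBinom_succ (a : ℝ) (i : ℕ) :
    genBinom a (i + 1) = genBinom a i * (a - i) / (i + 1) := by
  rw [genBinom, genBinom, Finset.prod_range_succ, Nat.factorial_succ]
  push_cast
  field_simp

theorem hasSum_genBinom_mul_pow (a : ℝ) {x : ℝ} (hx : |x| < 1) :
    HasSum (fun i : ℕ => genBinom a i * x ^ i) ((1 + x) ^ a) := by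
  have h := (Real.one_add_rpow_hasFPowerSeriesOnBall_zero (a := a)).hasSum (y := x)
    (by simpa [enorm, ← NNReal.coe_lt_coe] using hx)
  simpa only [binomialSeries_apply, ← genBinom_eq_choose, List.ofFn_const, List.prod_replicate,
    smul_eq_mul, zero_add] using h

/-- The telescoping bound `∑_{1 ≤ i ≤ n} |C(1/2, i)| = 1 - 2(n+1)|C(1/2, n+1)|`. -/
theorem sum_abs_genBinom_half_succ (n : ℕ) :
    ∑ i ∈ Finset.range n, |genBinom (1 / 2) (i + 1)| =
      1 - 2 * (n + 1) * |genBinom (1 / 2) (n + 1)| := by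
  induction n with
  | zero => simp [genBinom]
  | succ n ih =>
    have h : |genBinom (1 / 2) (n + 1 + 1)| =
        |genBinom (1 / 2) (n + 1)| * (n + 1 / 2) / (n + 2) := by
      rw [genBinom_succ, abs_div, abs_mul, abs_sub_comm]
      push_cast
      rw [abs_of_pos (by positivity : (0 : ℝ) < n + 1 + 1),
        abs_of_pos (by linarith [n.cast_nonneg (α := ℝ)] : (0 : ℝ) < n + 1 - 1 / 2)]
      ring
    rw [Finset.sum_range_succ, ih, h]
    push_cast
    field_simp
    ring

theorem summable_genBinom_half : Summable (genBinom (1 / 2)) := by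
  rw [← summable_nat_add_iff 1]
  refine Summable.of_abs (summable_of_sum_range_le (c := 1) (fun _ => abs_nonneg _) fun n => ?_)
  rw [sum_abs_genBinom_half_succ]
  have : (0 : ℝ) ≤ 2 * (n + 1) * |genBinom (1 / 2) (n + 1)| := by positivity
  linarith

theorem hasSum_genBinom_half : HasSum (genBinom (1 / 2)) (√2) := by
  have h := Real.tendsto_tsum_powerSeries_nhdsWithin_lt
    summable_genBinom_half.hasSum.tendsto_sum_nat
  have h' : Filter.Tendsto (fun x : ℝ => (1 + x) ^ (1 / 2 : ℝ)) (nhdsWithin 1 (Set.Iio 1))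
      (nhds (√2)) := by
    have hc : ContinuousAt (fun x : ℝ => (1 + x) ^ (1 / 2 : ℝ)) 1 :=
      (continuousAt_const.add continuousAt_id).rpow_const (Or.inr (by norm_num))
    have := hc.tendsto.mono_left (nhdsWithin_le_nhds (s := Set.Iio 1))
    rwa [one_add_one_eq_two, ← Real.sqrt_eq_rpow] at this
  have heq : (fun x : ℝ => (1 + x) ^ (1 / 2 : ℝ)) =ᶠ[nhdsWithin 1 (Set.Iio 1)]
      fun x => ∑' n, genBinom (1 / 2) n * x ^ n := by
    filter_upwards [Ioo_mem_nhdsLT (zero_lt_one' ℝ)] with x hx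
    exact (hasSum_genBinom_mul_pow _ (by rw [abs_of_pos hx.1]; exact hx.2)).tsum_eq.symm
  rw [← tendsto_nhds_unique h (h'.congr' heq)]
  exact summable_genBinom_half.hasSum

/-- The physicists' Hermite polynomials. -/
noncomputable def physHermite : ℕ → Polynomial ℝ
  | 0 => 1
  | n + 1 => 2 * Polynomial.X * physHermite n - Polynomial.derivative (physHermite n)

theorem derivative_physHermite_succ (n : ℕ) :
    Polynomial.derivative (physHermite (n + 1)) = (2 * (n + 1) : ℕ) * physHermite n := by
  induction n with
  | zero => simp [physHermite]
  | succ n ih =>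
    have h := congrArg Polynomial.derivative ih
    rw [physHermite, map_sub, ih]
    simp only [Polynomial.derivative_mul, Polynomial.derivative_X, Polynomial.derivative_ofNat,
      Polynomial.derivative_natCast, ih]
    rw [physHermite]
    push_cast
    ring

/-- The unnormalized Hermite function `H_n(x) e^{-x²/2}`. -/
noncomputable def hermiteGauss (n : ℕ) (x : ℝ) : ℝ :=
  (physHermite n).eval x * exp (-x ^ 2 / 2)

theorem hasDerivAt_exp_neg_sq_div_two (x : ℝ) :
    HasDerivAt (fun x : ℝ => exp (-x ^ 2 / 2)) (exp (-x ^ 2 / 2) * -x) x := by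
  have : HasDerivAt (fun x : ℝ => -x ^ 2 / 2) (-x) x :=
    (((hasDerivAt_pow 2 x).neg).div_const 2).congr_deriv (by norm_num; ring)
  exact this.exp

theorem hasDerivAt_hermiteGauss (n : ℕ) (x : ℝ) :
    HasDerivAt (hermiteGauss n) (x * hermiteGauss n x - hermiteGauss (n + 1) x) x := by
  refine (((physHermite n).hasDerivAt x).mul (hasDerivAt_exp_neg_sq_div_two x)).congr_deriv ?_
  simp only [hermiteGauss, physHermite, Polynomial.eval_sub, Polynomial.eval_mul,
    Polynomial.eval_ofNat, Polynomial.eval_X]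
  ring

theorem hermiteGauss_add_two (n : ℕ) (x : ℝ) :
    hermiteGauss (n + 2) x = 2 * x * hermiteGauss (n + 1) x - 2 * (n + 1) * hermiteGauss n x := by
  rw [hermiteGauss, physHermite, derivative_physHermite_succ]
  simp only [hermiteGauss, Polynomial.eval_sub, Polynomial.eval_mul,
    Polynomial.eval_ofNat, Polynomial.eval_X, Polynomial.eval_natCast]
  push_cast
  ring

theorem hasDerivAt_hermiteGauss_succ (n : ℕ) (x : ℝ) :
    HasDerivAt (hermiteGauss (n + 1))
      (2 * (n + 1) * hermiteGauss n x - x * hermiteGauss (n + 1) x) x :=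
  (hasDerivAt_hermiteGauss (n + 1) x).congr_deriv (by rw [hermiteGauss_add_two]; ring)

theorem continuous_hermiteGauss (n : ℕ) : Continuous (hermiteGauss n) :=
  continuous_iff_continuousAt.2 fun x => (hasDerivAt_hermiteGauss n x).continuousAt

theorem hermiteGauss_neg (n : ℕ) (x : ℝ) :
    hermiteGauss n (-x) = (-1) ^ n * hermiteGauss n x := by
  induction n using Nat.twoStepInduction with
  | zero => simp [hermiteGauss, physHermite]
  | one => simp [hermiteGauss, physHermite]
  | more n h₀ h₁ =>
    rw [hermiteGauss_add_two, hermiteGauss_add_two, h₀, h₁]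
    ring

theorem hermiteGauss_two_mul_neg (k : ℕ) (x : ℝ) :
    hermiteGauss (2 * k) (-x) = hermiteGauss (2 * k) x := by
  simp [hermiteGauss_neg]

theorem hermiteGauss_two_mul_add_one_zero (k : ℕ) : hermiteGauss (2 * k + 1) 0 = 0 := by
  have h := hermiteGauss_neg (2 * k + 1) 0
  rw [neg_zero, (odd_two_mul_add_one k).neg_one_pow] at h
  linarith

theorem iteratedDeriv_exp_neg_sq (n : ℕ) :
    iteratedDeriv n (fun s : ℝ => exp (-s ^ 2)) =
      fun x => (-1) ^ n * (hermiteGauss n x * exp (-x ^ 2 / 2)) := by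
  induction n with
  | zero =>
    ext x
    simp only [iteratedDeriv_zero, hermiteGauss, physHermite, Polynomial.eval_one, pow_zero,
      one_mul, ← exp_add]
    ring_nf
  | succ n ih =>
    ext x
    rw [iteratedDeriv_succ, ih]
    refine ((((hasDerivAt_hermiteGauss n x).mul (hasDerivAt_exp_neg_sq_div_two x)).const_mul
      ((-1) ^ n)).congr_deriv ?_).deriv
    ring

theorem hermiteFun_eq (n : ℕ) (x : ℝ) :
    hermiteFun n x = ((2 : ℝ) ^ n * n.factorial * √π) ^ (-(1 : ℝ) / 2) * hermiteGauss n x := by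
  have h : exp (x ^ 2 / 2) * exp (-x ^ 2 / 2) = 1 := by rw [← exp_add]; ring_nf; simp
  have h' : ((-1 : ℝ) ^ n) * (-1) ^ n = 1 := by rw [← mul_pow]; simp
  rw [hermiteFun, iteratedDeriv_exp_neg_sq]
  calc _ = ((-1 : ℝ) ^ n * (-1) ^ n) * (exp (x ^ 2 / 2) * exp (-x ^ 2 / 2)) *
        (((2 : ℝ) ^ n * n.factorial * √π) ^ (-(1 : ℝ) / 2) * hermiteGauss n x) := by ring
    _ = _ := by rw [h, h', one_mul, one_mul]

theorem exists_abs_eval_mul_exp_le (p : Polynomial ℝ) :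
    ∃ C, ∀ x : ℝ, |p.eval x * exp (-x ^ 2 / 2)| ≤ C * exp (-|x|) := by
  induction p using Polynomial.induction_on' with
  | add p q hp hq =>
    obtain ⟨C, hC⟩ := hp
    obtain ⟨D, hD⟩ := hq
    refine ⟨C + D, fun x => ?_⟩
    rw [Polynomial.eval_add, add_mul, add_mul]
    exact (abs_add_le _ _).trans (add_le_add (hC x) (hD x))
  | monomial n a =>
    refine ⟨|a| * n.factorial * exp 2, fun x => ?_⟩
    have h₁ : |x| ^ n ≤ n.factorial * exp |x| := by
      have := pow_div_factorial_le_exp |x| (abs_nonneg x) n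
      rwa [div_le_iff₀' (by positivity)] at this
    have h₂ : exp |x| * exp (-x ^ 2 / 2) ≤ exp 2 * exp (-|x|) := by
      rw [← exp_add, ← exp_add, exp_le_exp, ← sq_abs]
      nlinarith [sq_nonneg (|x| - 2)]
    rw [Polynomial.eval_monomial, abs_mul, abs_mul, abs_pow, abs_of_pos (exp_pos _)]
    calc |a| * |x| ^ n * exp (-x ^ 2 / 2)
        ≤ |a| * (n.factorial * exp |x|) * exp (-x ^ 2 / 2) := by gcongr
      _ = |a| * n.factorial * (exp |x| * exp (-x ^ 2 / 2)) := by ring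
      _ ≤ |a| * n.factorial * (exp 2 * exp (-|x|)) := by gcongr
      _ = _ := by ring

theorem exists_abs_hermiteGauss_le (n : ℕ) :
    ∃ C, ∀ x : ℝ, |hermiteGauss n x| ≤ C * exp (-|x|) :=
  exists_abs_eval_mul_exp_le _

theorem integrable_hermiteGauss (n : ℕ) : Integrable (hermiteGauss n) := by
  obtain ⟨C, hC⟩ := exists_abs_hermiteGauss_le n
  have hint : Integrable fun x : ℝ => exp (-|x|) := by
    rw [← integrableOn_univ, ← Set.Iic_union_Ioi (a := (0 : ℝ))]
    refine ((integrableOn_exp_Iic 0).congr_fun (fun x hx => ?_) measurableSet_Iic).union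
      ((integrableOn_exp_neg_Ioi 0).congr_fun (fun x hx => ?_) measurableSet_Ioi)
    · simp [abs_of_nonpos (Set.mem_Iic.1 hx)]
    · simp [abs_of_pos (Set.mem_Ioi.1 hx)]
  exact (hint.const_mul C).mono' (continuous_hermiteGauss n).aestronglyMeasurable
    (Filter.Eventually.of_forall hC)

/-- The tail integral `∫_x^∞ H_n(t) e^{-t²/2} dt`. -/
noncomputable def hermiteTail (n : ℕ) (x : ℝ) : ℝ := ∫ t in Set.Ioi x, hermiteGauss n t

theorem hasDerivAt_hermiteTail (n : ℕ) (x : ℝ) :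
    HasDerivAt (hermiteTail n) (-hermiteGauss n x) x := by
  have h : hermiteTail n = fun x => hermiteTail n 0 - ∫ t in (0 : ℝ)..x, hermiteGauss n t := by
    ext x
    rw [hermiteTail, hermiteTail, ← intervalIntegral.integral_interval_add_Ioi (a := 0) (b := x)
      (integrable_hermiteGauss n).integrableOn (integrable_hermiteGauss n).integrableOn,
      add_sub_cancel_left]
  rw [h]
  exact ((continuous_hermiteGauss n).integral_hasStrictDerivAt 0 x).hasDerivAt.const_sub _

theorem continuous_hermiteTail (n : ℕ) : Continuous (hermiteTail n) :=
  continuous_iff_continuousAt.2 fun x => (hasDerivAt_hermiteTail n x).continuousAt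

theorem exists_abs_hermiteTail_le (n : ℕ) :
    ∃ C, ∀ x : ℝ, 0 ≤ x → |hermiteTail n x| ≤ C * exp (-x) := by
  obtain ⟨C, hC⟩ := exists_abs_hermiteGauss_le n
  refine ⟨C, fun x hx => ?_⟩
  rw [hermiteTail, ← norm_eq_abs, ← integral_exp_neg_Ioi x, ← integral_const_mul]
  refine norm_integral_le_of_norm_le ((integrableOn_exp_neg_Ioi x).const_mul C) ?_
  refine (ae_restrict_iff' measurableSet_Ioi).2 (Filter.Eventually.of_forall fun t ht => ?_)
  simpa [abs_of_pos (hx.trans_lt ht)] using hC t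

theorem integrableOn_hermiteTail_sq (n : ℕ) :
    IntegrableOn (fun x => hermiteTail n x ^ 2) (Set.Ioi 0) := by
  obtain ⟨C, hC⟩ := exists_abs_hermiteTail_le n
  refine ((integrableOn_exp_neg_Ioi 0).const_mul (C ^ 2)).mono'
    ((continuous_hermiteTail n).pow 2).aestronglyMeasurable ?_
  refine (ae_restrict_iff' measurableSet_Ioi).2 (Filter.Eventually.of_forall fun t ht => ?_)
  have h1 : exp (-t) ≤ 1 := exp_le_one_iff.2 (neg_nonpos.2 (le_of_lt ht))
  rw [norm_pow, norm_eq_abs]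
  calc |hermiteTail n t| ^ 2 ≤ (C * exp (-t)) ^ 2 := by
        gcongr; exact hC t (le_of_lt ht)
    _ = C ^ 2 * (exp (-t) * exp (-t)) := by ring
    _ ≤ C ^ 2 * (1 * exp (-t)) := by gcongr
    _ = _ := by ring

open Filter Topology in
theorem tendsto_hermiteGauss_atTop (n : ℕ) : Tendsto (hermiteGauss n) atTop (𝓝 0) := by
  obtain ⟨C, hC⟩ := exists_abs_hermiteGauss_le n
  refine squeeze_zero_norm hC ?_
  have := (tendsto_exp_neg_atTop_nhds_zero.comp tendsto_abs_atTop_atTop).const_mul C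
  simpa [Function.comp_def] using this

open Filter Topology in
theorem tendsto_hermiteTail_atTop (n : ℕ) : Tendsto (hermiteTail n) atTop (𝓝 0) := by
  obtain ⟨C, hC⟩ := exists_abs_hermiteTail_le n
  refine squeeze_zero_norm' ((eventually_ge_atTop 0).mono hC) ?_
  simpa using tendsto_exp_neg_atTop_nhds_zero.const_mul C

open Filter Topology in
theorem tendsto_mul_hermiteTail_sq_atTop (n : ℕ) :
    Tendsto (fun x => x * hermiteTail n x ^ 2) atTop (𝓝 0) := by
  obtain ⟨C, hC⟩ := exists_abs_hermiteTail_le n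
  refine squeeze_zero_norm' (a := fun x => C * |hermiteTail n x|) ?_ ?_
  · filter_upwards [eventually_ge_atTop 0] with x hx
    have h1 : x * exp (-x) ≤ 1 := by
      rw [exp_neg, ← div_eq_mul_inv, div_le_one (exp_pos x)]
      linarith [add_one_le_exp x]
    have hC0 : 0 ≤ C := by
      have := (abs_nonneg _).trans (hC 0 le_rfl)
      simpa using this
    rw [norm_mul, norm_pow, norm_eq_abs, norm_eq_abs, abs_of_nonneg hx]
    calc x * |hermiteTail n x| ^ 2 = x * |hermiteTail n x| * |hermiteTail n x| := by ring
      _ ≤ x * (C * exp (-x)) * |hermiteTail n x| := by gcongr; exact hC x hx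
      _ = C * (x * exp (-x)) * |hermiteTail n x| := by ring
      _ ≤ C * 1 * |hermiteTail n x| := by gcongr
      _ = _ := by ring
  · simpa using (tendsto_hermiteTail_atTop n).abs.const_mul C

theorem hermiteTail_add_two (n : ℕ) (x : ℝ) :
    hermiteTail (n + 2) x = 2 * (n + 1) * hermiteTail n x + 2 * hermiteGauss (n + 1) x := by
  have hint : Integrable fun t =>
      2 * (n + 1) * hermiteGauss n t - hermiteGauss (n + 2) t :=
    ((integrable_hermiteGauss n).const_mul _).sub (integrable_hermiteGauss (n + 2))
  have h := integral_Ioi_of_hasDerivAt_of_tendsto' (a := x)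
    (f := fun t => 2 * hermiteGauss (n + 1) t)
    (fun t _ => ((hasDerivAt_hermiteGauss_succ n t).const_mul 2).congr_deriv (f' := _)
      (g' := 2 * (n + 1) * hermiteGauss n t - hermiteGauss (n + 2) t)
      (by rw [hermiteGauss_add_two]; ring))
    hint.integrableOn ((tendsto_hermiteGauss_atTop (n + 1)).const_mul 2)
  rw [integral_sub ((integrable_hermiteGauss n).const_mul _).integrableOn
    (integrable_hermiteGauss (n + 2)).integrableOn, integral_const_mul] at h
  simp only [hermiteTail]
  linarith

theorem integral_hermiteTail_add_two_sq (k : ℕ) :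
    ∫ x in Set.Ioi 0, hermiteTail (2 * k + 2) x ^ 2 =
      4 * (2 * k + 1) * (2 * k + 2) * (∫ x in Set.Ioi 0, hermiteTail (2 * k) x ^ 2) +
        8 * (2 * k + 1) * (hermiteGauss (2 * k) 0 * hermiteTail (2 * k) 0) := by
  set n := 2 * k with hn
  have hderiv : ∀ x ∈ Set.Ici (0 : ℝ), HasDerivAt
      (fun x => -4 * (n + 1) * (x * hermiteTail n x ^ 2 + 2 * (hermiteGauss n x * hermiteTail n x))
        - 4 * (hermiteGauss n x * hermiteGauss (n + 1) x))
      (hermiteTail (n + 2) x ^ 2 - 4 * (n + 1) * (n + 2) * hermiteTail n x ^ 2) x := by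
    intro x _
    have hA := hasDerivAt_hermiteTail n x
    have ha := hasDerivAt_hermiteGauss n x
    have hb := hasDerivAt_hermiteGauss_succ n x
    refine (((((hasDerivAt_id x).mul (hA.pow 2)).add ((ha.mul hA).const_mul 2)).const_mul
      (-4 * (n + 1 : ℝ))).sub ((ha.mul hb).const_mul 4)).congr_deriv ?_
    rw [hermiteTail_add_two]
    simp
    ring
  have h := integral_Ioi_of_hasDerivAt_of_tendsto' hderiv
    ((integrableOn_hermiteTail_sq (n + 2)).sub ((integrableOn_hermiteTail_sq n).const_mul _))
    ((((tendsto_mul_hermiteTail_sq_atTop n).add (((tendsto_hermiteGauss_atTop n).mul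
      (tendsto_hermiteTail_atTop n)).const_mul 2)).const_mul (-4 * (n + 1 : ℝ))).sub
      (((tendsto_hermiteGauss_atTop n).mul (tendsto_hermiteGauss_atTop (n + 1))).const_mul 4))
  rw [integral_sub (integrableOn_hermiteTail_sq (n + 2))
    ((integrableOn_hermiteTail_sq n).const_mul _), integral_const_mul] at h
  have h0 : hermiteGauss (n + 1) 0 = 0 := hermiteGauss_two_mul_add_one_zero k
  rw [h0] at h
  have hnc : (n : ℝ) = 2 * k := by simp [hn]
  rw [hnc] at h
  linear_combination h

theorem hermiteGauss_zero (x : ℝ) : hermiteGauss 0 x = exp (-x ^ 2 / 2) := by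
  simp [hermiteGauss, physHermite]

theorem hermiteTail_zero_zero : hermiteTail 0 0 = √π * √2 / 2 := by
  have h := integral_gaussian_Ioi (1 / 2)
  rw [← sqrt_mul pi_pos.le, hermiteTail]
  simp_rw [hermiteGauss_zero]
  convert h using 2
  · ext x; ring_nf
  · ring_nf

theorem integral_hermiteTail_zero_sq :
    ∫ x in Set.Ioi 0, hermiteTail 0 x ^ 2 = √π * (√2 - 1) := by
  have hderiv : ∀ x ∈ Set.Ici (0 : ℝ), HasDerivAt
      (fun x => x * hermiteTail 0 x ^ 2 - 2 * (hermiteGauss 0 x * hermiteTail 0 x))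
      (hermiteTail 0 x ^ 2 + 2 * exp (-1 * x ^ 2)) x := by
    intro x _
    have hA := hasDerivAt_hermiteTail 0 x
    have ha : HasDerivAt (hermiteGauss 0) (-x * hermiteGauss 0 x) x := by
      refine (hasDerivAt_hermiteGauss 0 x).congr_deriv ?_
      simp [hermiteGauss, physHermite]
      ring
    have hsq : exp (-1 * x ^ 2) = hermiteGauss 0 x ^ 2 := by
      rw [hermiteGauss_zero, ← exp_nat_mul]
      ring_nf
    refine (((hasDerivAt_id x).mul (hA.pow 2)).sub ((ha.mul hA).const_mul 2)).congr_deriv ?_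
    rw [hsq]
    simp
    ring
  have hexp : IntegrableOn (fun x : ℝ => 2 * exp (-1 * x ^ 2)) (Set.Ioi 0) :=
    ((integrable_exp_neg_mul_sq one_pos).const_mul 2).integrableOn
  have h := integral_Ioi_of_hasDerivAt_of_tendsto' hderiv
    ((integrableOn_hermiteTail_sq 0).add hexp)
    ((tendsto_mul_hermiteTail_sq_atTop 0).sub (((tendsto_hermiteGauss_atTop 0).mul
      (tendsto_hermiteTail_atTop 0)).const_mul 2))
  rw [integral_add (integrableOn_hermiteTail_sq 0) hexp, integral_const_mul,
    integral_gaussian_Ioi, hermiteTail_zero_zero, hermiteGauss_zero] at h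
  simp at h
  linear_combination h

theorem Xeven_eq_hermiteTail_abs (k : ℕ) (x : ℝ) :
    Xeven k x = -(((2 : ℝ) ^ (2 * k) * (2 * k).factorial * √π) ^ (-(1 : ℝ) / 2) *
      hermiteTail (2 * k) |x|) := by
  set c := ((2 : ℝ) ^ (2 * k) * (2 * k).factorial * √π) ^ (-(1 : ℝ) / 2)
  have hX : ∀ y, Xeven k y = c * ∫ t in Set.Iic y, Real.sign t * hermiteGauss (2 * k) t := by
    intro y
    rw [Xeven, ← integral_const_mul]
    simp_rw [hermiteFun_eq]
    congr 1 with t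
    ring
  rw [hX, ← mul_neg]
  congr 1
  rcases lt_or_ge x 0 with hx | hx
  · have h : ∫ t in Set.Iic x, Real.sign t * hermiteGauss (2 * k) t =
        ∫ t in Set.Iic x, -hermiteGauss (2 * k) (-t) := by
      refine setIntegral_congr_fun measurableSet_Iic fun t ht => ?_
      simp [Real.sign_of_neg (lt_of_le_of_lt ht hx), hermiteGauss_two_mul_neg]
    rw [h, integral_neg, integral_comp_neg_Iic, abs_of_neg hx, hermiteTail]
  · have hsign : Measurable Real.sign :=
      Measurable.ite measurableSet_Iio measurable_const
        (Measurable.ite measurableSet_Ioi measurable_const measurable_const)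
    have hint : Integrable fun t => Real.sign t * hermiteGauss (2 * k) t := by
      refine (integrable_hermiteGauss (2 * k)).bdd_mul (c := 1)
        hsign.aestronglyMeasurable (Filter.Eventually.of_forall fun t => ?_)
      rcases Real.sign_apply_eq t with h | h | h <;> simp [h]
    have hodd : ∫ t, Real.sign t * hermiteGauss (2 * k) t = 0 := by
      have h := integral_neg_eq_self (fun t => Real.sign t * hermiteGauss (2 * k) t) volume
      simp only [Real.sign_neg, hermiteGauss_two_mul_neg, neg_mul, integral_neg] at h
      linarith
    have hpos : ∫ t in Set.Ioi x, Real.sign t * hermiteGauss (2 * k) t = hermiteTail (2 * k) x := by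
      refine setIntegral_congr_fun measurableSet_Ioi fun t ht => ?_
      simp [Real.sign_of_pos (lt_of_le_of_lt hx ht)]
    have h := intervalIntegral.integral_Iic_add_Ioi (b := x) hint.integrableOn hint.integrableOn
    rw [hodd, hpos] at h
    rw [abs_of_nonneg hx]
    linarith

theorem hermiteGauss_mul_hermiteTail_zero (k : ℕ) :
    hermiteGauss (2 * k) 0 * hermiteTail (2 * k) 0 =
      2 ^ (2 * k) * (2 * k).factorial * √π * (√2 * (k + 1) * genBinom (1 / 2) (k + 1)) := by
  induction k with
  | zero =>
    simp [hermiteGauss_zero, hermiteTail_zero_zero, genBinom]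
    ring
  | succ k ih =>
    rw [show 2 * (k + 1) = 2 * k + 2 by ring, hermiteTail_add_two, hermiteGauss_add_two,
      hermiteGauss_two_mul_add_one_zero, genBinom_succ, Nat.factorial_succ, Nat.factorial_succ]
    push_cast
    have hk : (k + 1 + 1 : ℝ) * (genBinom (1 / 2) (k + 1) * (1 / 2 - (k + 1)) / (k + 1 + 1)) =
        genBinom (1 / 2) (k + 1) * (1 / 2 - (k + 1)) := mul_div_cancel₀ _ (by positivity)
    rw [mul_assoc (√2), hk]
    linear_combination (-4 * (2 * k + 1 : ℝ) ^ 2) * ih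

theorem integral_hermiteTail_two_mul_sq (k : ℕ) :
    ∫ x in Set.Ioi 0, hermiteTail (2 * k) x ^ 2 =
      2 ^ (2 * k) * (2 * k).factorial * √π *
        (√2 * ∑ i ∈ Finset.range (k + 1), genBinom (1 / 2) i - 1) := by
  induction k with
  | zero => simp [integral_hermiteTail_zero_sq, genBinom]
  | succ k ih =>
    rw [show 2 * (k + 1) = 2 * k + 2 by ring, integral_hermiteTail_add_two_sq, ih,
      hermiteGauss_mul_hermiteTail_zero, Finset.sum_range_succ _ (k + 1), Nat.factorial_succ,
      Nat.factorial_succ]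
    push_cast
    ring

theorem integral_Xeven_sq (k : ℕ) :
    ∫ x, Xeven k x ^ 2 = 2 * (√2 * ∑ i ∈ Finset.range (k + 1), genBinom (1 / 2) i - 1) := by
  have hpos : 0 < (2 : ℝ) ^ (2 * k) * (2 * k).factorial * √π := by positivity
  have hsq : (((2 : ℝ) ^ (2 * k) * (2 * k).factorial * √π) ^ (-(1 : ℝ) / 2)) ^ 2 =
      ((2 : ℝ) ^ (2 * k) * (2 * k).factorial * √π)⁻¹ := by
    rw [← rpow_natCast, ← rpow_mul hpos.le, ← rpow_neg_one]
    norm_num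
  simp_rw [Xeven_eq_hermiteTail_abs, neg_sq, mul_pow _ (hermiteTail _ _), hsq]
  rw [integral_const_mul, integral_comp_abs (f := fun x => hermiteTail (2 * k) x ^ 2),
    integral_hermiteTail_two_mul_sq]
  field_simp

theorem even_antiderivative_L2_limit :
    Filter.Tendsto (fun k : ℕ => ∫ x : ℝ, (Xeven k x) ^ 2) Filter.atTop (nhds 2) ∧
      ∑' i : ℕ, genBinom (1 / 2) i = Real.sqrt 2 := by
  refine ⟨?_, hasSum_genBinom_half.tsum_eq⟩
  simp_rw [integral_Xeven_sq]
  have h := (((hasSum_genBinom_half.tendsto_sum_nat.comp (Filter.tendsto_add_atTop_nat 1)).const_mul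
    (√2)).sub_const 1).const_mul 2
  rw [mul_self_sqrt zero_le_two] at h
  norm_num at h
  simpa [Function.comp_def] using h
end

section
/- There exists a constant C > 0 such that for every k ≥ 1, (X_{2k}(0))² = (1/4)(∫_ℝ h_{2k}(t) dt)² ≤ C · k^{−1/2}; consequently, for multi-indices with α₁ even, α₁ ≥ (α₂+α₃)/2, and α₁ ≠ 0, one has (X_{α₁}(0))² · (α₂+α₃+1)^{1/2} ≤ C' for a constant C' independent of α. -/
open MeasureTheory Real

/-- `X_m(x) = ∫_{−∞}^x sign(t) h_m(t) dt` (used for even indices `m`). -/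
noncomputable def Xev (m : ℕ) (x : ℝ) : ℝ :=
  ∫ t in Set.Iic x, Real.sign t * hermiteFun m t

open Polynomial in
/-- The polynomials `p_k` with `(d/dt)^k e^{-t²} = p_k(t) e^{-t²}`. -/
noncomputable def gaussDerivPoly : ℕ → ℝ[X]
  | 0 => 1
  | k + 1 => derivative (gaussDerivPoly k) - 2 * X * gaussDerivPoly k

open Polynomial in
lemma derivative_gaussDerivPoly_succ (k : ℕ) :
    derivative (gaussDerivPoly (k + 1)) = -2 * ((k : ℝ[X]) + 1) * gaussDerivPoly k := by
  induction k with
  | zero => simp [gaussDerivPoly]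
  | succ k ih =>
    rw [gaussDerivPoly, map_sub, ih]
    simp only [derivative_mul, derivative_X, ih, derivative_neg, derivative_ofNat, derivative_add,
      derivative_natCast, derivative_one, Nat.cast_add, Nat.cast_one]
    rw [show gaussDerivPoly (k + 1) = derivative (gaussDerivPoly k) - 2 * X * gaussDerivPoly k
      from rfl]
    ring

lemma iteratedDeriv_exp_neg_sq_s17 (k : ℕ) :
    iteratedDeriv k (fun s : ℝ => Real.exp (-s ^ 2)) =
      fun t => (gaussDerivPoly k).eval t * Real.exp (-t ^ 2) := by
  induction k with
  | zero => simp [gaussDerivPoly]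
  | succ k ih =>
    ext t
    rw [iteratedDeriv_succ, ih]
    have hexp : HasDerivAt (fun s : ℝ => Real.exp (-s ^ 2)) (Real.exp (-t ^ 2) * (-(2 * t))) t := by
      simpa using ((hasDerivAt_pow 2 t).neg).exp
    refine (((gaussDerivPoly k).hasDerivAt t).fun_mul hexp).deriv.trans ?_
    simp only [gaussDerivPoly, Polynomial.eval_sub, Polynomial.eval_mul, Polynomial.eval_X,
      Polynomial.eval_ofNat]
    ring

lemma integrable_eval_mul_exp_neg_sq_half (p : Polynomial ℝ) :
    Integrable fun t : ℝ => p.eval t * Real.exp (-t ^ 2 / 2) := by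
  induction p using Polynomial.induction_on' with
  | add p q hp hq => simpa only [Polynomial.eval_add, add_mul] using hp.fun_add hq
  | monomial n a =>
    have h := (integrable_rpow_mul_exp_neg_mul_sq (b := 1 / 2) (by norm_num) (s := n)
      (by linarith [n.cast_nonneg (α := ℝ)])).const_mul a
    refine h.congr (.of_forall fun t => ?_)
    simp only [Polynomial.eval_monomial, Real.rpow_natCast]
    rw [show -(1 / 2) * t ^ 2 = -t ^ 2 / 2 by ring]
    ring

open Polynomial in
/-- Gaussian integration by parts for polynomials. -/
lemma integral_X_mul_exp_neg_sq_half (p : ℝ[X]) :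
    ∫ t : ℝ, (X * p).eval t * Real.exp (-t ^ 2 / 2) =
      ∫ t : ℝ, (derivative p).eval t * Real.exp (-t ^ 2 / 2) := by
  rw [eq_comm, ← sub_eq_zero, ← integral_sub (integrable_eval_mul_exp_neg_sq_half _)
    (integrable_eval_mul_exp_neg_sq_half _)]
  refine integral_eq_zero_of_hasDerivAt_of_integrable (fun t => ?_)
    ((integrable_eval_mul_exp_neg_sq_half _).sub (integrable_eval_mul_exp_neg_sq_half _))
    (integrable_eval_mul_exp_neg_sq_half p)
  have hexp : HasDerivAt (fun s : ℝ => Real.exp (-s ^ 2 / 2)) (Real.exp (-t ^ 2 / 2) * (-t)) t := by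
    refine ((((hasDerivAt_pow 2 t).fun_neg).div_const 2).exp).congr_deriv ?_
    norm_num
    ring
  refine ((p.hasDerivAt t).fun_mul hexp).congr_deriv ?_
  simp only [eval_mul, eval_X]
  ring

open Polynomial in
lemma integral_gaussDerivPoly_add_two (k : ℕ) :
    ∫ t : ℝ, (gaussDerivPoly (k + 2)).eval t * Real.exp (-t ^ 2 / 2) =
      2 * (k + 1) * ∫ t : ℝ, (gaussDerivPoly k).eval t * Real.exp (-t ^ 2 / 2) := by
  have hd : ∀ t : ℝ, (derivative (gaussDerivPoly (k + 1))).eval t * Real.exp (-t ^ 2 / 2) =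
      -2 * (k + 1) * ((gaussDerivPoly k).eval t * Real.exp (-t ^ 2 / 2)) := fun t => by
    rw [derivative_gaussDerivPoly_succ]
    simp only [eval_mul, eval_neg, eval_ofNat, eval_add, eval_natCast, eval_one]
    ring
  have hX := integral_X_mul_exp_neg_sq_half (gaussDerivPoly (k + 1))
  have hrec : ∀ t : ℝ, (gaussDerivPoly (k + 2)).eval t * Real.exp (-t ^ 2 / 2) =
      (derivative (gaussDerivPoly (k + 1))).eval t * Real.exp (-t ^ 2 / 2) -
        2 * ((X * gaussDerivPoly (k + 1)).eval t * Real.exp (-t ^ 2 / 2)) := fun t => by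
    rw [gaussDerivPoly]
    simp only [eval_sub, eval_mul, eval_X, eval_ofNat]
    ring
  simp_rw [hrec]
  rw [integral_sub (integrable_eval_mul_exp_neg_sq_half _)
    ((integrable_eval_mul_exp_neg_sq_half _).const_mul 2), integral_const_mul, hX]
  simp_rw [hd]
  rw [integral_const_mul]
  ring

lemma hermiteFun_eq_s17 (k : ℕ) (t : ℝ) :
    hermiteFun k t =
      (-1 : ℝ) ^ k * ((2 : ℝ) ^ k * (Nat.factorial k : ℝ) * Real.sqrt π) ^ (-(1 : ℝ) / 2) *
        ((gaussDerivPoly k).eval t * Real.exp (-t ^ 2 / 2)) := by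
  have hexp : Real.exp (-t ^ 2 / 2) = Real.exp (t ^ 2 / 2) * Real.exp (-t ^ 2) := by
    rw [← Real.exp_add]
    ring_nf
  rw [hermiteFun, iteratedDeriv_exp_neg_sq_s17, hexp]
  ring

lemma integrable_hermiteFun (k : ℕ) : Integrable (hermiteFun k) :=
  ((integrable_eval_mul_exp_neg_sq_half _).const_mul _).congr
    (.of_forall fun t => (hermiteFun_eq_s17 k t).symm)

lemma hermiteFun_neg (k : ℕ) (t : ℝ) : hermiteFun (2 * k) (-t) = hermiteFun (2 * k) t := by
  have h := iteratedDeriv_comp_neg (2 * k) (fun s : ℝ => Real.exp (-s ^ 2)) t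
  simp only [neg_sq, even_two_mul, Even.neg_pow, one_pow, one_smul] at h
  simp only [hermiteFun, neg_sq, h]

lemma Xev_zero (k : ℕ) : Xev (2 * k) 0 = -(1 / 2) * ∫ t : ℝ, hermiteFun (2 * k) t := by
  have hneg : Xev (2 * k) 0 = -∫ t in Set.Iic 0, hermiteFun (2 * k) t := by
    rw [Xev, integral_Iic_eq_integral_Iio, integral_Iic_eq_integral_Iio, ← integral_neg]
    refine setIntegral_congr_fun measurableSet_Iio fun t ht => ?_
    simp only [Real.sign_of_neg ht, neg_one_mul]
  have hsymm : ∫ t in Set.Ioi 0, hermiteFun (2 * k) t = ∫ t in Set.Iic 0, hermiteFun (2 * k) t := by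
    simpa [hermiteFun_neg] using (integral_comp_neg_Iic 0 (hermiteFun (2 * k))).symm
  have hsum := intervalIntegral.integral_Iic_add_Ioi (b := 0)
    (integrable_hermiteFun (2 * k)).integrableOn (integrable_hermiteFun (2 * k)).integrableOn
  rw [hneg, ← hsum, hsymm]
  ring

lemma sq_integral_hermiteFun (k : ℕ) :
    (∫ t : ℝ, hermiteFun k t) ^ 2 =
      (∫ t : ℝ, (gaussDerivPoly k).eval t * Real.exp (-t ^ 2 / 2)) ^ 2 /
        ((2 : ℝ) ^ k * (Nat.factorial k : ℝ) * Real.sqrt π) := by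
  have hpos : 0 < (2 : ℝ) ^ k * (Nat.factorial k : ℝ) * Real.sqrt π := by positivity
  simp_rw [hermiteFun_eq_s17]
  rw [integral_const_mul, mul_pow, mul_pow, ← pow_mul, mul_comm k 2, pow_mul, neg_one_sq, one_pow,
    one_mul, ← Real.rpow_natCast (_ ^ (-(1 : ℝ) / 2)), ← Real.rpow_mul hpos.le]
  norm_num [Real.rpow_neg_one, div_eq_inv_mul]

lemma sq_integral_hermiteFun_succ (k : ℕ) :
    (∫ t : ℝ, hermiteFun (2 * (k + 1)) t) ^ 2 =
      (2 * k + 1) / (2 * k + 2) * (∫ t : ℝ, hermiteFun (2 * k) t) ^ 2 := by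
  have hk : (0 : ℝ) < 2 * k + 1 := by positivity
  rw [sq_integral_hermiteFun, sq_integral_hermiteFun, show 2 * (k + 1) = 2 * k + 2 by ring,
    integral_gaussDerivPoly_add_two, Nat.factorial_succ, Nat.factorial_succ]
  push_cast
  field_simp
  ring

lemma sq_integral_hermiteFun_zero : (∫ t : ℝ, hermiteFun 0 t) ^ 2 = 2 * √π := by
  have h := integral_gaussian (1 / 2)
  have hexp : ∀ t : ℝ, -t ^ 2 / 2 = -(1 / 2) * t ^ 2 := fun t => by ring
  have hπ : √π ^ 2 = π := Real.sq_sqrt pi_pos.le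
  rw [sq_integral_hermiteFun]
  simp only [gaussDerivPoly, Polynomial.eval_one, one_mul, hexp, h]
  rw [Real.sq_sqrt (by positivity)]
  field_simp
  simp [hπ]

lemma sq_sq_integral_hermiteFun_le (k : ℕ) :
    ((∫ t : ℝ, hermiteFun (2 * k) t) ^ 2) ^ 2 * (2 * k + 1) ≤ 4 * π := by
  induction k with
  | zero =>
    simp [sq_integral_hermiteFun_zero, mul_pow, Real.sq_sqrt pi_pos.le]
    norm_num
  | succ k ih =>
    refine le_trans ?_ ih
    rw [sq_integral_hermiteFun_succ, mul_pow, mul_comm (_ ^ 2), mul_assoc]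
    refine mul_le_mul_of_nonneg_left ?_ (sq_nonneg _)
    rw [div_pow, div_mul_eq_mul_div, div_le_iff₀ (by positivity)]
    push_cast
    have hk : (0 : ℝ) ≤ k := k.cast_nonneg
    nlinarith

lemma sq_Xev_zero (k : ℕ) :
    (Xev (2 * k) 0) ^ 2 = (1 / 4) * (∫ t : ℝ, hermiteFun (2 * k) t) ^ 2 := by
  rw [Xev_zero]
  ring

lemma sq_Xev_zero_mul_sqrt_le (k : ℕ) {s : ℝ} (hs : 0 ≤ s) (hsk : s ≤ 2 * (2 * k + 1)) :
    (Xev (2 * k) 0) ^ 2 * √s ≤ √π := by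
  refine Real.le_sqrt_of_sq_le ?_
  have h := sq_sq_integral_hermiteFun_le k
  rw [mul_pow, Real.sq_sqrt hs, sq_Xev_zero, mul_pow]
  have h' := mul_le_mul_of_nonneg_left hsk
    (sq_nonneg ((∫ t : ℝ, hermiteFun (2 * k) t) ^ 2))
  nlinarith [pi_pos]

theorem Xeven_at_zero_decay :
    (∃ C > 0, ∀ k : ℕ, 1 ≤ k →
        (Xev (2 * k) 0) ^ 2 = (1 / 4) * (∫ t : ℝ, hermiteFun (2 * k) t) ^ 2 ∧
        (Xev (2 * k) 0) ^ 2 ≤ C * (k : ℝ) ^ (-(1 : ℝ) / 2)) ∧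
      (∃ C' > 0, ∀ α₁ α₂ α₃ : ℕ, Even α₁ → α₁ ≠ 0 →
        ((α₂ : ℝ) + (α₃ : ℝ)) / 2 ≤ (α₁ : ℝ) →
        (Xev α₁ 0) ^ 2 * ((α₂ : ℝ) + (α₃ : ℝ) + 1) ^ ((1 : ℝ) / 2) ≤ C') := by
  refine ⟨⟨√π, by positivity, fun k hk => ⟨sq_Xev_zero k, ?_⟩⟩, √π, by positivity, ?_⟩
  · have hk0 : (0 : ℝ) < k := by exact_mod_cast hk
    rw [neg_div, Real.rpow_neg hk0.le, ← Real.sqrt_eq_rpow, ← div_eq_mul_inv,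
      le_div_iff₀ (Real.sqrt_pos.2 hk0)]
    exact sq_Xev_zero_mul_sqrt_le k hk0.le (by linarith)
  · intro α₁ α₂ α₃ heven _ hle
    obtain ⟨k, rfl⟩ := heven.exists_two_nsmul
    rw [smul_eq_mul] at hle ⊢
    push_cast at hle
    rw [← Real.sqrt_eq_rpow]
    exact sq_Xev_zero_mul_sqrt_le k (by positivity) (by linarith)
end
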